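/- The function f(x₁,x₂,x₃,x₄) = 2(x₂−x₃)(x₂−x₄)/(x₁−x₂), defined on the open set U = {x ∈ ℝ⁴ : x₁ ≠ x₂}, satisfies on U all four equations of the dispersionless Hirota system (case A₀) and the heavenly equation (case A₀) (x₁−x₂)(x₃−x₄)f₁₂f₃₄ − (x₁−x₃)(x₂−x₄)f₁₃f₂₄ + (x₁−x₄)(x₂−x₃)f₁₄f₂₃ = 0. -/

import Mathlib

/-- Partial derivative `∂f/∂x_j` on ℝ⁴ (coordinates `x₁,…,x₄` are indexed by `Fin 4`,
so `x_i` corresponds to index `i-1`). -/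
noncomputable def pd (f : (Fin 4 → ℝ) → ℝ) (j : Fin 4) (x : Fin 4 → ℝ) : ℝ :=
  fderiv ℝ f x (Pi.single j 1)

/-- Second partial derivative `∂²f/∂x_i∂x_j` on ℝ⁴. -/
noncomputable def pd2 (f : (Fin 4 → ℝ) → ℝ) (i j : Fin 4) (x : Fin 4 → ℝ) : ℝ :=
  pd (pd f j) i x

section PartialDerivatives

variable {f g : (Fin 4 → ℝ) → ℝ} {x : Fin 4 → ℝ}

theorem pd_const (c : ℝ) (j : Fin 4) (x : Fin 4 → ℝ) : pd (fun _ => c) j x = 0 := by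
  simp [pd]

theorem pd_coord (i j : Fin 4) (x : Fin 4 → ℝ) :
    pd (fun y => y i) j x = if i = j then 1 else 0 := by
  have h : HasFDerivAt (fun y : Fin 4 → ℝ => y i) (ContinuousLinearMap.proj i) x :=
    (ContinuousLinearMap.proj (R := ℝ) (φ := fun _ : Fin 4 => ℝ) i).hasFDerivAt
  simp [pd, h.fderiv, Pi.single_apply]

theorem pd_add (hf : DifferentiableAt ℝ f x) (hg : DifferentiableAt ℝ g x) (j : Fin 4) :
    pd (fun y => f y + g y) j x = pd f j x + pd g j x := by
  simp [pd, fderiv_fun_add hf hg]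

theorem pd_sub (hf : DifferentiableAt ℝ f x) (hg : DifferentiableAt ℝ g x) (j : Fin 4) :
    pd (fun y => f y - g y) j x = pd f j x - pd g j x := by
  simp [pd, fderiv_fun_sub hf hg]

theorem pd_mul (hf : DifferentiableAt ℝ f x) (hg : DifferentiableAt ℝ g x) (j : Fin 4) :
    pd (fun y => f y * g y) j x = f x * pd g j x + g x * pd f j x := by
  simp [pd, fderiv_fun_mul hf hg]

theorem pd_div (hf : DifferentiableAt ℝ f x) (hg : DifferentiableAt ℝ g x) (hx : g x ≠ 0)
    (j : Fin 4) :
    pd (fun y => f y / g y) j x = (pd f j x * g x - f x * pd g j x) / (g x * g x) := by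
  have h := hf.hasFDerivAt.mul ((hasDerivAt_inv hx).comp_hasFDerivAt x hg.hasFDerivAt)
  have hfg : (fun y => f y / g y) = f * (Inv.inv ∘ g) := by
    ext y
    simp [div_eq_mul_inv]
  rw [pd, hfg, h.fderiv]
  simp only [pd, add_apply, smul_apply, smul_eq_mul, Function.comp_apply]
  field_simp
  ring

/-- Two functions agreeing off the hyperplane `x₁ = x₂` have the same partial derivatives
there. -/
theorem pd_congr_of_ne (h : ∀ y : Fin 4 → ℝ, y 0 ≠ y 1 → f y = g y) (hx : x 0 ≠ x 1)
    (j : Fin 4) : pd f j x = pd g j x := by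
  have hU : IsOpen {y : Fin 4 → ℝ | y 0 ≠ y 1} :=
    isOpen_ne_fun (continuous_apply 0) (continuous_apply 1)
  have he : f =ᶠ[nhds x] g := Filter.eventually_of_mem (hU.mem_nhds hx) h
  rw [pd, pd, he.fderiv_eq]

end PartialDerivatives

/-- The partial derivatives of the solution, over the common denominator `(x₁ - x₂)²`. -/
theorem pd_solution (j : Fin 4) (x : Fin 4 → ℝ) (hx : x 0 ≠ x 1) :
    pd (fun y => 2 * (y 1 - y 2) * (y 1 - y 3) / (y 0 - y 1)) j x =
      (2 * ((x 1 - x 2) * ((if 1 = j then 1 else 0) - (if 3 = j then 1 else 0))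
          + (x 1 - x 3) * ((if 1 = j then 1 else 0) - (if 2 = j then 1 else 0))) * (x 0 - x 1)
        - 2 * (x 1 - x 2) * (x 1 - x 3) * ((if 0 = j then 1 else 0) - (if 1 = j then 1 else 0)))
      / ((x 0 - x 1) * (x 0 - x 1)) := by
  have hd : x 0 - x 1 ≠ 0 := sub_ne_zero.mpr hx
  simp (disch := first | assumption | fun_prop) only
    [pd_div, pd_mul, pd_sub, pd_const, pd_coord]
  ring

/-- The second partial derivatives of the solution. -/
theorem pd2_solution (i j : Fin 4) (x : Fin 4 → ℝ) (hx : x 0 ≠ x 1) :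
    pd2 (fun y => 2 * (y 1 - y 2) * (y 1 - y 3) / (y 0 - y 1)) i j x =
      pd (fun x => (2 * ((x 1 - x 2) * ((if 1 = j then 1 else 0) - (if 3 = j then 1 else 0))
          + (x 1 - x 3) * ((if 1 = j then 1 else 0) - (if 2 = j then 1 else 0))) * (x 0 - x 1)
        - 2 * (x 1 - x 2) * (x 1 - x 3) * ((if 0 = j then 1 else 0) - (if 1 = j then 1 else 0)))
      / ((x 0 - x 1) * (x 0 - x 1))) i x :=
  pd_congr_of_ne (fun y hy => pd_solution j y hy) hx i

/-- The function `f = 2(x₂−x₃)(x₂−x₄)/(x₁−x₂)` on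
`U = {x : x₁ ≠ x₂}` satisfies all four equations of the dispersionless Hirota system
(case A₀) and the heavenly equation (case A₀). -/
theorem example_solution_hirota_and_heavenly_A0 :
    ∀ x : Fin 4 → ℝ, x 0 ≠ x 1 →
      (let f : (Fin 4 → ℝ) → ℝ := fun y => 2 * (y 1 - y 2) * (y 1 - y 3) / (y 0 - y 1)
       (pd f 0 x * pd2 f 1 2 x * (x 1 - x 2) + pd f 1 x * pd2 f 0 2 x * (x 2 - x 0)
          + pd f 2 x * pd2 f 0 1 x * (x 0 - x 1) = 0)
       ∧
       (pd f 0 x * pd2 f 1 3 x * (x 1 - x 3) + pd f 1 x * pd2 f 0 3 x * (x 3 - x 0)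
          + pd f 3 x * pd2 f 0 1 x * (x 0 - x 1) = 0)
       ∧
       (pd f 0 x * pd2 f 2 3 x * (x 2 - x 3) + pd f 2 x * pd2 f 0 3 x * (x 3 - x 0)
          + pd f 3 x * pd2 f 0 2 x * (x 0 - x 2) = 0)
       ∧
       (pd f 1 x * pd2 f 2 3 x * (x 2 - x 3) + pd f 2 x * pd2 f 1 3 x * (x 3 - x 1)
          + pd f 3 x * pd2 f 1 2 x * (x 1 - x 2) = 0)
       ∧
       ((x 0 - x 1) * (x 2 - x 3) * pd2 f 0 1 x * pd2 f 2 3 x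
          - (x 0 - x 2) * (x 1 - x 3) * pd2 f 0 2 x * pd2 f 1 3 x
          + (x 0 - x 3) * (x 1 - x 2) * pd2 f 0 3 x * pd2 f 1 2 x = 0)) := by
  intro x hx
  have hd : x 0 - x 1 ≠ 0 := sub_ne_zero.mpr hx
  have hdd : (x 0 - x 1) * (x 0 - x 1) ≠ 0 := mul_ne_zero hd hd
  intro f
  simp only [f, pd_solution _ x hx, pd2_solution _ _ x hx]
  simp (disch := first | assumption | fun_prop (disch := assumption)) only
    [pd_div, pd_mul, pd_sub, pd_add, pd_const, pd_coord]
  simp only [Fin.reduceEq, if_true, if_false]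
  refine ⟨?_, ?_, ?_, ?_, ?_⟩ <;> field_simp <;> ring
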